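/- Let p ≥ 3 be an odd integer and n an integer with n ≡ 2 (mod 4) and 10 ≤ n ≤ 4p. Then the Graovac–Pisanski index of AT(n,p) satisfies Ŵ(AT(n,p)) = (p+1)·(n⁴/48 + (3n³p)/4 + (3n³)/4 + n²p² + 2n²p + (11n²)/12 − np − n). -/

import Mathlib

open SimpleGraph

/-- Base relation for the armchair nanotube `AT(n,p)`: vertices are pairs `(i, j)` with
layer `i ∈ {0, …, p}` and position `j ∈ ℤ/2nℤ`.  `(i,j)` is related to `(i, j+1)`,
and to `(i+1, j-1)` when `j ≡ 2 (mod 4)`, and to `(i+1, j+1)` when `j ≡ 3 (mod 4)`. -/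
def ATRel (n p : ℕ) (u v : Fin (p + 1) × ZMod (2 * n)) : Prop :=
  (u.1 = v.1 ∧ v.2 = u.2 + 1) ∨
    ((u.1 : ℕ) + 1 = (v.1 : ℕ) ∧
      ((u.2.val % 4 = 2 ∧ v.2 = u.2 - 1) ∨ (u.2.val % 4 = 3 ∧ v.2 = u.2 + 1)))

/-- The armchair nanotube `AT(n,p)` as a simple graph. -/
def AT (n p : ℕ) : SimpleGraph (Fin (p + 1) × ZMod (2 * n)) :=
  SimpleGraph.fromRel (ATRel n p)

/-- `Vset n p k i` is the set `V^k_i` of vertices of type `k` in layer `i` of `AT(n,p)`: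
type `0` means `j mod 4 ∈ {0,1}`, type `1` means `j mod 4 ∈ {2,3}`. -/
def Vset (n p : ℕ) (k i : ℕ) : Set (Fin (p + 1) × ZMod (2 * n)) :=
  {v | (v.1 : ℕ) = i ∧ v.2.val % 4 / 2 = k}

/-- The set of vertices of `AT(n,p)` in layer `i` (the vertex set of the induced
cycle `C1` for `i = 0`, and of `C2` for `i = p`). -/
def layer (n p : ℕ) (i : ℕ) : Set (Fin (p + 1) × ZMod (2 * n)) :=
  {v | (v.1 : ℕ) = i}

/-- The Graovac–Pisanski index of a graph `G`:
`Ŵ(G) = (|V(G)| / (2 |Aut(G)|)) * Σ_u Σ_α d(u, α(u))`. -/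
noncomputable def GPindex {V : Type*} (G : SimpleGraph V) : ℚ :=
  ((Nat.card V : ℚ) / (2 * (Nat.card (G ≃g G) : ℚ))) *
    ∑ᶠ u : V, ∑ᶠ α : G ≃g G, (G.dist u (α u) : ℚ)


/-- Adjacency in the universal cover, on integer positions. -/
def LA (a : ℕ) (x : ℤ) (b : ℕ) (y : ℤ) : Prop :=
  (a = b ∧ (y = x + 1 ∨ y = x - 1)) ∨
  (a + 1 = b ∧ ((x % 4 = 2 ∧ y = x - 1) ∨ (x % 4 = 3 ∧ y = x + 1))) ∨
  (b + 1 = a ∧ ((x % 4 = 1 ∧ y = x + 1) ∨ (x % 4 = 0 ∧ y = x - 1)))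

lemma val_mod4 (n : ℕ) (hn4 : n % 4 = 2) (x : ℤ) :
    ((((x : ℤ) : ZMod (2 * n)).val : ℕ) : ℤ) % 4 = x % 4 := by
  have : NeZero (2 * n) := ⟨by omega⟩
  rw [ZMod.val_intCast]
  apply Int.emod_emod_of_dvd
  push_cast
  omega

lemma one_ne (n : ℕ) (hn : 10 ≤ n) : (1 : ZMod (2 * n)) ≠ 0 := by
  have : Fact (1 < 2 * n) := ⟨by omega⟩
  exact one_ne_zero

lemma cast_eq_iff (n : ℕ) (x y : ℤ) :
    (x : ZMod (2 * n)) = (y : ZMod (2 * n)) ↔ ∃ l : ℤ, y = x + (2 * n) * l := by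
  rw [ZMod.intCast_eq_intCast_iff_dvd_sub]
  constructor
  · rintro ⟨l, hl⟩
    refine ⟨l, ?_⟩
    push_cast at hl
    linarith
  · rintro ⟨l, hl⟩
    refine ⟨l, ?_⟩
    push_cast
    linarith

lemma adj_of_LA (n p : ℕ) (hn4 : n % 4 = 2) (hn : 10 ≤ n) (a b : Fin (p + 1)) (x y : ℤ)
    (h : LA a x b y) : (AT n p).Adj (a, (x : ZMod (2 * n))) (b, (y : ZMod (2 * n))) := by
  have h1 := one_ne n hn
  have vx := val_mod4 n hn4 x
  have vy := val_mod4 n hn4 y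
  rw [AT, SimpleGraph.fromRel_adj]
  constructor
  · intro e
    have e1 : (x : ZMod (2 * n)) = (y : ZMod (2 * n)) := (Prod.mk.inj e).2
    rw [cast_eq_iff] at e1
    obtain ⟨l, hl⟩ := e1
    have : y = x + 1 ∨ y = x - 1 := by
      unfold LA at h; omega
    have h2 : (n : ℤ) * l * 2 = 1 ∨ (n : ℤ) * l * 2 = -1 := by
      rcases this with h | h
      · left; linarith
      · right; linarith
    omega
  · unfold ATRel
    simp only
    rcases h with ⟨h, h' | h'⟩ | ⟨h, ⟨h', h''⟩ | ⟨h', h''⟩⟩ | ⟨h, ⟨h', h''⟩ | ⟨h', h''⟩⟩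
    · left; left; exact ⟨Fin.ext h, by rw [h']; push_cast; ring⟩
    · right; left; exact ⟨Fin.ext h.symm, by rw [h']; push_cast; ring⟩
    · left; right; exact ⟨h, Or.inl ⟨by omega, by rw [h'']; push_cast; ring⟩⟩
    · left; right; exact ⟨h, Or.inr ⟨by omega, by rw [h'']; push_cast; ring⟩⟩
    · right; right; exact ⟨h, Or.inl ⟨by omega, by rw [h'']; push_cast; ring⟩⟩
    · right; right; exact ⟨h, Or.inr ⟨by omega, by rw [h'']; push_cast; ring⟩⟩

lemma LA_of_adj (n p : ℕ) (hn4 : n % 4 = 2) (a : Fin (p + 1)) (x : ℤ)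
    (v : Fin (p + 1) × ZMod (2 * n))
    (h : (AT n p).Adj (a, (x : ZMod (2 * n))) v) :
    ∃ y : ℤ, v = (v.1, (y : ZMod (2 * n))) ∧ LA a x v.1 y := by
  obtain ⟨b, z⟩ := v
  have vx := val_mod4 n hn4 x
  have v1 := val_mod4 n hn4 (x + 1)
  have v2 := val_mod4 n hn4 (x - 1)
  push_cast at v1 v2
  rw [AT, SimpleGraph.fromRel_adj] at h
  obtain ⟨-, h⟩ := h
  unfold ATRel at h
  simp only at h
  have hz : z = (x : ZMod (2 * n)) + 1 ∨ z = (x : ZMod (2 * n)) - 1 := by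
    rcases h with (⟨_, h⟩ | ⟨_, ⟨_, h⟩ | ⟨_, h⟩⟩) | (⟨_, h⟩ | ⟨_, ⟨_, h⟩ | ⟨_, h⟩⟩)
    · left; exact h
    · right; exact h
    · left; exact h
    · right; rw [h]; ring
    · left; rw [h]; ring
    · right; rw [h]; ring
  unfold LA
  simp only
  rcases h with (⟨h0, h⟩ | ⟨h0, ⟨h', h⟩ | ⟨h', h⟩⟩) | (⟨h0, h⟩ | ⟨h0, ⟨h', h⟩ | ⟨h', h⟩⟩)
  · exact ⟨x + 1, by rw [h]; push_cast; rfl, by simp [h0]⟩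
  · exact ⟨x - 1, by rw [h]; push_cast; rfl, by omega⟩
  · exact ⟨x + 1, by rw [h]; push_cast; rfl, by omega⟩
  · have : z = (x : ZMod (2 * n)) - 1 := by rw [h]; ring
    exact ⟨x - 1, by rw [this]; push_cast; rfl, by simp [h0]⟩
  · have : z = (x : ZMod (2 * n)) + 1 := by rw [h]; ring
    rw [this] at h'
    exact ⟨x + 1, by rw [this]; push_cast; rfl, by omega⟩
  · have : z = (x : ZMod (2 * n)) - 1 := by rw [h]; ring
    rw [this] at h'
    exact ⟨x - 1, by rw [this]; push_cast; rfl, by omega⟩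

/-! ### Distances -/

def sp (z : ℤ) : ℤ := 2 * (z / 4) + z % 4
def sm (z : ℤ) : ℤ := -2 * (z / 4) - z % 2

lemma walk_lower (n p : ℕ) (hn4 : n % 4 = 2) (u v : Fin (p + 1) × ZMod (2 * n))
    (w : (AT n p).Walk u v) : ∀ x : ℤ, u.2 = (x : ZMod (2 * n)) →
    ∃ y : ℤ, v.2 = (y : ZMod (2 * n)) ∧ y - x ≤ w.length ∧ x - y ≤ w.length ∧
      2 * ((v.1 : ℕ) - (u.1 : ℕ) : ℤ) + sp y - sp x ≤ w.length ∧
      2 * ((v.1 : ℕ) - (u.1 : ℕ) : ℤ) + sm y - sm x ≤ w.length := by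
  induction w with
  | nil => intro x hx; exact ⟨x, hx, by simp⟩
  | @cons u u' v h w ih =>
    intro x hx
    obtain ⟨a, z⟩ := u
    simp only at hx
    subst hx
    obtain ⟨x', hx', hla⟩ := LA_of_adj n p hn4 a x u' h
    obtain ⟨y, hy, h1, h2, h3, h4⟩ := ih x' (by rw [hx'])
    refine ⟨y, hy, ?_⟩
    simp only [SimpleGraph.Walk.length_cons]
    push_cast
    unfold LA at hla
    unfold sp at *
    unfold sm at *
    clear ih hy hx'
    refine ⟨by omega, by omega, by omega, by omega⟩

lemma walk_upper (n p : ℕ) (hn4 : n % 4 = 2) (hn : 10 ≤ n) (b : Fin (p + 1)) (y : ℤ) (N : ℕ) :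
    ∀ (a : Fin (p + 1)) (x : ℤ), (a : ℕ) ≤ b →
    ((x ≤ y ∧ y - x ≤ N ∧ 2 * ((b : ℕ) - (a : ℕ) : ℤ) + sp y - sp x ≤ N) ∨
     (y ≤ x ∧ x - y ≤ N ∧ 2 * ((b : ℕ) - (a : ℕ) : ℤ) + sm y - sm x ≤ N)) →
    ∃ w : (AT n p).Walk (a, (x : ZMod (2 * n))) (b, (y : ZMod (2 * n))), w.length ≤ N := by
  induction N with
  | zero =>
    intro a x hab h
    have hxy : x = y := by omega
    subst hxy
    have : a = b := Fin.ext (by omega)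
    subst this
    exact ⟨SimpleGraph.Walk.nil, by simp⟩
  | succ N ih =>
    intro a x hab h
    have key : (x = y ∧ a = b) ∨ ∃ (a' : ℕ) (x' : ℤ), LA a x a' x' ∧ a' ≤ b ∧
      ((x' ≤ y ∧ y - x' ≤ N ∧ 2 * ((b : ℕ) - (a' : ℕ) : ℤ) + sp y - sp x' ≤ N) ∨
       (y ≤ x' ∧ x' - y ≤ N ∧ 2 * ((b : ℕ) - (a' : ℕ) : ℤ) + sm y - sm x' ≤ N)) := by
      rw [Fin.ext_iff]
      obtain ⟨a, ha⟩ := a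
      obtain ⟨b, hb⟩ := b
      simp only at hab h ⊢
      clear ih
      unfold LA sp sm at *
      push_cast at h
      rcases lt_trichotomy x y with hxy | hxy | hxy
      · right
        by_cases h3 : x % 4 = 3 ∧ a < b
        · exact ⟨a + 1, x + 1, by omega, by omega, by omega⟩
        · exact ⟨a, x + 1, by omega, by omega, by omega⟩
      · by_cases hlt : a < b
        · right
          have : x % 4 = 0 ∨ x % 4 = 1 ∨ x % 4 = 2 ∨ x % 4 = 3 := by omega
          rcases this with h4 | h4 | h4 | h4
          · exact ⟨a, x - 1, by omega, by omega, by omega⟩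
          · exact ⟨a, x + 1, by omega, by omega, by omega⟩
          · exact ⟨a + 1, x - 1, by omega, by omega, by omega⟩
          · exact ⟨a + 1, x + 1, by omega, by omega, by omega⟩
        · left; omega
      · right
        by_cases h3 : x % 4 = 2 ∧ a < b
        · exact ⟨a + 1, x - 1, by omega, by omega, by omega⟩
        · exact ⟨a, x - 1, by omega, by omega, by omega⟩
    rcases key with ⟨rfl, rfl⟩ | ⟨a', x', hla, hle, hh⟩
    · exact ⟨SimpleGraph.Walk.nil, by simp⟩
    · obtain ⟨w, hw⟩ := ih ⟨a', by omega⟩ x' hle hh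
      refine ⟨SimpleGraph.Walk.cons (adj_of_LA n p hn4 hn a ⟨a', by omega⟩ x x' hla) w, ?_⟩
      simp only [SimpleGraph.Walk.length_cons]
      omega

lemma dist_eval (n p : ℕ) (hn4 : n % 4 = 2) (hn : 10 ≤ n) (a b : Fin (p + 1)) (x y y0 : ℤ) (N : ℕ)
    (hab : (a : ℕ) ≤ b) (hy0 : ∃ l : ℤ, y0 = y + (2 * n) * l)
    (hup : (x ≤ y0 ∧ y0 - x ≤ N ∧ 2 * ((b : ℕ) - (a : ℕ) : ℤ) + sp y0 - sp x ≤ N) ∨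
     (y0 ≤ x ∧ x - y0 ≤ N ∧ 2 * ((b : ℕ) - (a : ℕ) : ℤ) + sm y0 - sm x ≤ N))
    (hlow : ∀ z : ℤ, (z = y ∨ z = y - 2 * n ∨ z = y + 2 * n ∨ z ≤ y - 4 * n ∨ y + 4 * n ≤ z) →
      z % 4 = y % 4 →
      (N : ℤ) ≤ z - x ∨ (N : ℤ) ≤ x - z ∨ (N : ℤ) ≤ 2 * ((b : ℕ) - (a : ℕ) : ℤ) + sp z - sp x ∨
      (N : ℤ) ≤ 2 * ((b : ℕ) - (a : ℕ) : ℤ) + sm z - sm x) :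
    (AT n p).dist (a, (x : ZMod (2 * n))) (b, (y : ZMod (2 * n))) = N := by
  have hc : (y : ZMod (2 * n)) = (y0 : ZMod (2 * n)) := (cast_eq_iff n y y0).2 hy0
  obtain ⟨w, hw⟩ := walk_upper n p hn4 hn b y0 N a x hab hup
  rw [← hc] at w
  apply le_antisymm
  · rw [hc]
    obtain ⟨w, hw⟩ := walk_upper n p hn4 hn b y0 N a x hab hup
    exact (SimpleGraph.dist_le w).trans hw
  · obtain ⟨w', hw'⟩ := (SimpleGraph.Walk.reachable w).exists_walk_length_eq_dist
    rw [← hw']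
    obtain ⟨z, hz, h1, h2, h3, h4⟩ := walk_lower n p hn4 _ _ w' x rfl
    obtain ⟨l, hl⟩ := (cast_eq_iff n y z).1 hz
    have hz4 : z % 4 = y % 4 := by
      have : (2 * (n : ℤ)) * l = 4 * ((n / 2 : ℤ) * l) := by
        have : (n : ℤ) = 2 * (n / 2) := by omega
        calc (2 * (n : ℤ)) * l = 2 * (2 * (n / 2)) * l := by rw [← this]
          _ = _ := by ring
      omega
    have hcase : (z = y ∨ z = y - 2 * n ∨ z = y + 2 * n ∨ z ≤ y - 4 * n ∨ y + 4 * n ≤ z) := by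
      have : l = 0 ∨ l = -1 ∨ l = 1 ∨ l ≤ -2 ∨ 2 ≤ l := by omega
      rcases this with h | h | h | h | h
      · left; rw [hl, h]; ring
      · right; left; rw [hl, h]; ring
      · right; right; left; rw [hl, h]; ring
      · right; right; right; left; nlinarith
      · right; right; right; right; nlinarith
    have := hlow z hcase hz4
    simp only at h3 h4
    omega

/-- Distance from a base point to the point at cyclic offset `x`, with layer parameter `s`. -/
def EE (n s x : ℕ) : ℕ :=
  if x ≤ n then x + 2 * (s - x / 4) else (2 * n - x) + 2 * (s - (2 * n - x) / 4)

lemma dist_same (n p : ℕ) (hn4 : n % 4 = 2) (hn : 10 ≤ n) (a : Fin (p + 1)) (x : ℕ)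
    (hx : x < 2 * n) :
    (AT n p).dist (a, ((0 : ℤ) : ZMod (2 * n))) (a, ((x : ℤ) : ZMod (2 * n))) = min x (2 * n - x) := by
  by_cases h : x ≤ n
  · refine dist_eval n p hn4 hn a a 0 x x _ le_rfl ⟨0, by ring⟩ ?_ ?_
    · left; unfold sp; omega
    · intro z hz hz4
      unfold sp sm
      omega
  · refine dist_eval n p hn4 hn a a 0 x (x - 2 * n) _ le_rfl ⟨-1, by ring⟩ ?_ ?_
    · right; unfold sm; omega
    · intro z hz hz4
      unfold sp sm
      omega

lemma dist_up (n p : ℕ) (hn4 : n % 4 = 2) (hn : 10 ≤ n) (a b : Fin (p + 1)) (x s : ℕ)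
    (hx : x < 2 * n) (hx4 : 2 ≤ x % 4) (hs : (b : ℕ) = a + s) :
    (AT n p).dist (a, ((0 : ℤ) : ZMod (2 * n))) (b, ((x : ℤ) : ZMod (2 * n))) = EE n s x := by
  by_cases h : x ≤ n
  · refine dist_eval n p hn4 hn a b 0 x x _ (by omega) ⟨0, by ring⟩ ?_ ?_
    · left; unfold sp EE; rw [if_pos h]; omega
    · intro z hz hz4
      unfold sp sm EE; rw [if_pos h]
      omega
  · refine dist_eval n p hn4 hn a b 0 x (x - 2 * n) _ (by omega) ⟨-1, by ring⟩ ?_ ?_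
    · right; unfold sm EE; rw [if_neg h]; omega
    · intro z hz hz4
      unfold sp sm EE; rw [if_neg h]
      omega

lemma dist_down (n p : ℕ) (hn4 : n % 4 = 2) (hn : 10 ≤ n) (a b : Fin (p + 1)) (x s : ℕ)
    (hx : x < 2 * n) (hx4 : 2 ≤ x % 4) (hs : (a : ℕ) = b + s + 1) :
    (AT n p).dist (a, ((0 : ℤ) : ZMod (2 * n))) (b, ((x : ℤ) : ZMod (2 * n))) = EE n s x := by
  rw [SimpleGraph.dist_comm]
  by_cases h : x ≤ n
  · refine dist_eval n p hn4 hn b a x 0 0 _ (by omega) ⟨0, by ring⟩ ?_ ?_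
    · right; unfold sm EE; rw [if_pos h]; omega
    · intro z hz hz4
      unfold sp sm EE; rw [if_pos h]
      omega
  · refine dist_eval n p hn4 hn b a x 0 (2 * n) _ (by omega) ⟨1, by ring⟩ ?_ ?_
    · left; unfold sp EE; rw [if_neg h]; omega
    · intro z hz hz4
      unfold sp sm EE; rw [if_neg h]
      omega

/-! ### Automorphisms -/

def atMap (n p : ℕ) (j : ℤ) (u : Fin (p + 1) × ZMod (2 * n)) : Fin (p + 1) × ZMod (2 * n) :=
  (if j % 4 < 2 then u.1 else Fin.rev u.1, if j % 2 = 0 then (j : ZMod (2 * n)) + u.2 else j - u.2)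

def atInv (j : ℤ) : ℤ := if j % 2 = 0 then -j else j

lemma atInv_atInv (j : ℤ) : atInv (atInv j) = j := by
  unfold atInv; split_ifs <;> omega

lemma atMap_inv (n p : ℕ) (j : ℤ) (u : Fin (p + 1) × ZMod (2 * n)) :
    atMap n p (atInv j) (atMap n p j u) = u := by
  obtain ⟨a, z⟩ := u
  unfold atMap atInv
  by_cases h2 : j % 2 = 0
  · have h2' : (-j) % 2 = 0 := by omega
    simp only [h2, h2', if_true]
    by_cases h4 : j % 4 < 2
    · have h4' : (-j) % 4 < 2 := by omega
      simp [h4, h4']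
    · have h4' : ¬ (-j) % 4 < 2 := by omega
      simp only [h4, h4', if_false]
      simp
  · simp only [h2, if_false]
    by_cases h4 : j % 4 < 2 <;> simp [h4]

lemma exists_lift (n : ℕ) (z : ZMod (2 * n)) : ∃ x : ℤ, z = (x : ZMod (2 * n)) :=
  ⟨_, (ZMod.intCast_surjective z).choose_spec.symm⟩

lemma LA_map1 (a b : ℕ) (x y j : ℤ) (h : LA a x b y) (h4 : j % 4 < 2) (h2 : j % 2 = 0) :
    LA a (j + x) b (j + y) := by
  have hj : j % 4 = 0 := by omega
  unfold LA at *
  rcases h with ⟨h, h' | h'⟩ | ⟨h, ⟨h', h''⟩ | ⟨h', h''⟩⟩ | ⟨h, ⟨h', h''⟩ | ⟨h', h''⟩⟩ <;> omega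

lemma LA_map2 (a b : ℕ) (x y j : ℤ) (h : LA a x b y) (h4 : j % 4 < 2) (h2 : ¬ j % 2 = 0) :
    LA a (j - x) b (j - y) := by
  have hj : j % 4 = 1 := by omega
  unfold LA at *
  rcases h with ⟨h, h' | h'⟩ | ⟨h, ⟨h', h''⟩ | ⟨h', h''⟩⟩ | ⟨h, ⟨h', h''⟩ | ⟨h', h''⟩⟩ <;> omega

lemma LA_map3 (a b a' b' p : ℕ) (x y j : ℤ) (h : LA a x b y) (h4 : ¬ j % 4 < 2) (h2 : j % 2 = 0)
    (ha : a + a' = p) (hb : b + b' = p) :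
    LA a' (j + x) b' (j + y) := by
  have hj : j % 4 = 2 := by omega
  unfold LA at *
  rcases h with ⟨h, h' | h'⟩ | ⟨h, ⟨h', h''⟩ | ⟨h', h''⟩⟩ | ⟨h, ⟨h', h''⟩ | ⟨h', h''⟩⟩ <;> omega

lemma LA_map4 (a b a' b' p : ℕ) (x y j : ℤ) (h : LA a x b y) (h4 : ¬ j % 4 < 2) (h2 : ¬ j % 2 = 0)
    (ha : a + a' = p) (hb : b + b' = p) :
    LA a' (j - x) b' (j - y) := by
  have hj : j % 4 = 3 := by omega
  unfold LA at *
  rcases h with ⟨h, h' | h'⟩ | ⟨h, ⟨h', h''⟩ | ⟨h', h''⟩⟩ | ⟨h, ⟨h', h''⟩ | ⟨h', h''⟩⟩ <;> omega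

lemma atMap_adj (n p : ℕ) (hn4 : n % 4 = 2) (hn : 10 ≤ n) (j : ℤ)
    (u v : Fin (p + 1) × ZMod (2 * n)) (h : (AT n p).Adj u v) :
    (AT n p).Adj (atMap n p j u) (atMap n p j v) := by
  obtain ⟨a, z⟩ := u
  obtain ⟨x, rfl⟩ := exists_lift n z
  obtain ⟨y, hy, hla⟩ := LA_of_adj n p hn4 a x v h
  obtain ⟨b, z⟩ := v
  have hz : z = (y : ZMod (2 * n)) := (Prod.mk.inj hy).2
  subst hz
  simp only at hla
  have ha := a.2
  have hb := b.2
  have e1 := Fin.val_rev a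
  have e2 := Fin.val_rev b
  clear h hy
  unfold atMap
  by_cases h4 : j % 4 < 2 <;> by_cases h2 : j % 2 = 0 <;> simp only [h4, h2, if_true, if_false]
  · have key := adj_of_LA n p hn4 hn a b (j + x) (j + y) (LA_map1 _ _ _ _ _ hla h4 h2)
    push_cast at key
    exact key
  · have key := adj_of_LA n p hn4 hn a b (j - x) (j - y) (LA_map2 _ _ _ _ _ hla h4 h2)
    push_cast at key
    exact key
  · have key := adj_of_LA n p hn4 hn a.rev b.rev (j + x) (j + y) (LA_map3 _ _ _ _ p _ _ _ hla h4 h2 (by omega) (by omega))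
    push_cast at key
    exact key
  · have key := adj_of_LA n p hn4 hn a.rev b.rev (j - x) (j - y) (LA_map4 _ _ _ _ p _ _ _ hla h4 h2 (by omega) (by omega))
    push_cast at key
    exact key

def atIso (n p : ℕ) (hn4 : n % 4 = 2) (hn : 10 ≤ n) (j : ℤ) : AT n p ≃g AT n p where
  toFun := atMap n p j
  invFun := atMap n p (atInv j)
  left_inv := atMap_inv n p j
  right_inv := fun u => by
    have := atMap_inv n p (atInv j) u
    rwa [atInv_atInv] at this
  map_rel_iff' := by
    intro u v
    refine ⟨fun h => ?_, fun h => atMap_adj n p hn4 hn j u v h⟩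
    have := atMap_adj n p hn4 hn (atInv j) _ _ h
    simpa [atMap_inv] using this

/-- Degree at most two. -/
def D2 {V : Type*} (G : SimpleGraph V) (u : V) : Prop :=
  ∀ a b c, G.Adj u a → G.Adj u b → G.Adj u c → a = b ∨ a = c ∨ b = c

lemma D2_iso {V : Type*} (G : SimpleGraph V) (γ : G ≃g G) (u : V) (h : D2 G u) : D2 G (γ u) := by
  intro a b c ha hb hc
  have f : ∀ a, G.Adj (γ u) a → G.Adj u (γ.symm a) := fun a ha => by
    have := γ.symm.map_adj_iff.2 ha
    simpa using this
  have := h _ _ _ (f a ha) (f b hb) (f c hc)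
  simpa using this

lemma D2_iff (n p : ℕ) (hn4 : n % 4 = 2) (hn : 10 ≤ n) (hp : 3 ≤ p) (a : Fin (p + 1)) (x : ℤ) :
    D2 (AT n p) (a, (x : ZMod (2 * n))) ↔
      (((a : ℕ) = 0 ∧ x % 4 < 2) ∨ ((a : ℕ) = p ∧ 2 ≤ x % 4)) := by
  constructor
  · intro h
    by_contra hc
    obtain ⟨b, y, hb, hab, hla⟩ : ∃ (b : ℕ) (y : ℤ), b < p + 1 ∧ (a : ℕ) ≠ b ∧ LA a x b y := by
      have ha := a.2
      have : x % 4 = 0 ∨ x % 4 = 1 ∨ x % 4 = 2 ∨ x % 4 = 3 := by omega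
      unfold LA
      rcases this with h4 | h4 | h4 | h4
      · exact ⟨a - 1, x - 1, by omega, by omega, by omega⟩
      · exact ⟨a - 1, x + 1, by omega, by omega, by omega⟩
      · exact ⟨a + 1, x - 1, by omega, by omega, by omega⟩
      · exact ⟨a + 1, x + 1, by omega, by omega, by omega⟩
    have := h _ _ _ (adj_of_LA n p hn4 hn a a x (x + 1) (by unfold LA; omega))
      (adj_of_LA n p hn4 hn a a x (x - 1) (by unfold LA; omega))
      (adj_of_LA n p hn4 hn a ⟨b, hb⟩ x y hla)
    simp only [Prod.mk.injEq, Fin.ext_iff] at this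
    rcases this with ⟨_, h1⟩ | ⟨h1, _⟩ | ⟨h1, _⟩
    · rw [cast_eq_iff] at h1
      obtain ⟨l, hl⟩ := h1
      have h2 : (n : ℤ) * l = -1 := by linarith
      have : (n : ℤ) ∣ 1 := ⟨-l, by linarith⟩
      have := Int.le_of_dvd (by norm_num) this
      omega
    · exact hab h1
    · exact hab h1
  · intro h v1 v2 v3 h1 h2 h3
    obtain ⟨y1, e1, l1⟩ := LA_of_adj n p hn4 a x v1 h1
    obtain ⟨y2, e2, l2⟩ := LA_of_adj n p hn4 a x v2 h2
    obtain ⟨y3, e3, l3⟩ := LA_of_adj n p hn4 a x v3 h3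
    have f : ∀ (v : Fin (p + 1) × ZMod (2 * n)) (y : ℤ), LA a x v.1 y →
        v.1 = a ∧ (y = x + 1 ∨ y = x - 1) := by
      intro v y l
      have hv := v.1.2
      rw [Fin.ext_iff]
      unfold LA at l
      omega
    obtain ⟨a1, b1⟩ := f _ _ l1
    obtain ⟨a2, b2⟩ := f _ _ l2
    obtain ⟨a3, b3⟩ := f _ _ l3
    rw [a1] at e1
    rw [a2] at e2
    rw [a3] at e3
    rw [e1, e2, e3]
    have : y1 = y2 ∨ y1 = y3 ∨ y2 = y3 := by omega
    rcases this with h | h | h <;> simp [h]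

lemma force (n p : ℕ) (hn4 : n % 4 = 2) (hn : 10 ≤ n) (γ : AT n p ≃g AT n p)
    (a b : Fin (p + 1)) (x y : ℤ)
    (hfix : γ (a, (x : ZMod (2 * n))) = (a, (x : ZMod (2 * n)))) (hla : LA a x b y)
    (hall : ∀ (b' : Fin (p + 1)) (y' : ℤ), LA a x b' y' → (b' = b ∧ y' = y) ∨
      γ (b', (y' : ZMod (2 * n))) = (b', (y' : ZMod (2 * n))) ∨
      γ (b, (y : ZMod (2 * n))) ≠ (b', (y' : ZMod (2 * n)))) :
    γ (b, (y : ZMod (2 * n))) = (b, (y : ZMod (2 * n))) := by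
  have h1 := γ.map_adj_iff.2 (adj_of_LA n p hn4 hn a b x y hla)
  rw [hfix] at h1
  obtain ⟨y', e, hla'⟩ := LA_of_adj n p hn4 a x _ h1
  generalize hb' : (γ (b, (y : ZMod (2 * n)))).1 = b' at e hla'
  rcases hall b' y' hla' with ⟨h, h'⟩ | h | h
  · rw [e, h, h']
  · rw [← h] at e
    have := γ.injective e
    rw [this]; exact h
  · exact absurd e h

lemma rigid (n p : ℕ) (hn4 : n % 4 = 2) (hn : 10 ≤ n) (hp : 3 ≤ p) (γ : AT n p ≃g AT n p)
    (h0 : γ (0, ((0 : ℤ) : ZMod (2 * n))) = (0, ((0 : ℤ) : ZMod (2 * n)))) :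
    ∀ u, γ u = u := by
  set F : Fin (p + 1) → ℤ → Prop := fun a x =>
    γ (a, (x : ZMod (2 * n))) = (a, (x : ZMod (2 * n))) with hF
  have hd : ∀ (a b : Fin (p + 1)) (x y : ℤ), γ (a, (x : ZMod (2 * n))) = (b, (y : ZMod (2 * n))) →
      (((a : ℕ) = 0 ∧ x % 4 < 2) ∨ ((a : ℕ) = p ∧ 2 ≤ x % 4)) →
      (((b : ℕ) = 0 ∧ y % 4 < 2) ∨ ((b : ℕ) = p ∧ 2 ≤ y % 4)) := by
    intro a b x y h hh
    rw [← D2_iff n p hn4 hn hp] at hh ⊢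
    rw [← h]
    exact D2_iso _ γ _ hh
  have z0 : ((0 : Fin (p + 1)) : ℕ) = 0 := rfl
  have layer0 : ∀ m : ℕ, F 0 (4 * m) ∧ F 0 (4 * m + 1) ∧ F 0 (4 * m + 2) ∧ F 0 (4 * m + 3) ∧
      F 0 (4 * m + 4) := by
    have base : ∀ m : ℕ, F 0 (4 * m) → F 0 (4 * m + 1) → F 0 (4 * m + 2) ∧ F 0 (4 * m + 3) ∧
      F 0 (4 * m + 4) ∧ F 0 (4 * m + 5) := by
      intro m f0 f1
      have f2 : F 0 (4 * m + 2) := by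
        refine force n p hn4 hn γ 0 0 (4 * m + 1) _ f1 (by unfold LA; omega) ?_
        intro b y h
        unfold LA at h
        have : b = 0 ∧ y = 4 * m + 2 ∨ b = 0 ∧ y = 4 * m := by rw [Fin.ext_iff]; omega
        rcases this with h | ⟨h, h'⟩
        · left; exact h
        · right; left; rw [h, h']; exact f0
      have f3 : F 0 (4 * m + 3) := by
        refine force n p hn4 hn γ 0 0 (4 * m + 2) _ f2 (by unfold LA; omega) ?_
        intro b y h
        unfold LA at h
        have : (b = 0 ∧ y = 4 * m + 3) ∨ (b = 0 ∧ y = 4 * m + 1) ∨ ((b : ℕ) = 1 ∧ y = 4 * m + 1) := by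
          rw [Fin.ext_iff]; omega
        rcases this with h | ⟨h, h'⟩ | ⟨h, h'⟩
        · left; exact h
        · right; left; rw [h, h']; exact f1
        · right; right
          intro e
          have h1 := γ.map_adj_iff.2 (adj_of_LA n p hn4 hn 0 0 (4 * m + 3) (4 * m + 4)
            (by unfold LA; omega))
          rw [e] at h1
          obtain ⟨y', e', hla'⟩ := LA_of_adj n p hn4 _ _ _ h1
          have := hd _ _ _ _ e' (by omega)
          unfold LA at hla'
          omega
      have f4 : F 0 (4 * m + 4) := by
        refine force n p hn4 hn γ 0 0 (4 * m + 3) _ f3 (by unfold LA; omega) ?_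
        intro b y h
        by_cases hc : b = 0 ∧ y = 4 * m + 4
        · left; exact hc
        · right; right
          intro e
          have := hd _ _ _ _ e (by omega)
          unfold LA at h
          rw [Fin.ext_iff] at hc
          omega
      refine ⟨f2, f3, f4, ?_⟩
      refine force n p hn4 hn γ 0 0 (4 * m + 4) _ f4 (by unfold LA; omega) ?_
      intro b y h
      unfold LA at h
      have : b = 0 ∧ y = 4 * m + 5 ∨ b = 0 ∧ y = 4 * m + 3 := by rw [Fin.ext_iff]; omega
      rcases this with h | ⟨h, h'⟩
      · left; exact h
      · right; left; rw [h, h']; exact f3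
    have both : ∀ m : ℕ, F 0 (4 * m) ∧ F 0 (4 * m + 1) := by
      intro m
      induction m with
      | zero =>
        refine ⟨h0, ?_⟩
        refine force n p hn4 hn γ 0 0 0 _ h0 (by unfold LA; omega) ?_
        intro b y h
        by_cases hc : b = 0 ∧ y = 1
        · left; simpa using hc
        · right; right
          intro e
          have := hd _ _ _ _ e (by omega)
          unfold LA at h
          rw [Fin.ext_iff] at hc
          omega
      | succ m ih =>
        obtain ⟨_, _, g4, g5⟩ := base m ih.1 ih.2
        have e4 : (4 * ((m + 1 : ℕ) : ℤ)) = 4 * m + 4 := by push_cast; ring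
        have e5 : (4 * ((m + 1 : ℕ) : ℤ)) + 1 = 4 * m + 5 := by push_cast; ring
        rw [e5, e4]
        exact ⟨g4, g5⟩
    intro m
    obtain ⟨h1, h2⟩ := both m
    obtain ⟨h3, h4, h5, _⟩ := base m h1 h2
    exact ⟨h1, h2, h3, h4, h5⟩
  have all0 : ∀ x : ℤ, F 0 x := by
    intro x
    have hpos : ∀ x : ℤ, 0 ≤ x → F 0 x := by
      intro x hx
      obtain ⟨g0, g1, g2, g3, _⟩ := layer0 (x / 4).toNat
      have hx4 : (((x / 4).toNat : ℕ) : ℤ) = x / 4 := Int.toNat_of_nonneg (by omega)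
      rw [hx4] at g0 g1 g2 g3
      have : x = 4 * (x / 4) ∨ x = 4 * (x / 4) + 1 ∨ x = 4 * (x / 4) + 2 ∨ x = 4 * (x / 4) + 3 := by
        omega
      rcases this with h | h | h | h <;> rw [h] <;> assumption
    have e : ((x : ℤ) : ZMod (2 * n)) = ((x + (2 * n) * |x| : ℤ) : ZMod (2 * n)) :=
      (cast_eq_iff n _ _).2 ⟨_, rfl⟩
    have := hpos (x + (2 * n) * |x|) (by
      have h1 := neg_abs_le x
      have h2 := abs_nonneg x
      have h3 : (10 : ℤ) ≤ n := by exact_mod_cast hn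
      nlinarith)
    simp only [hF] at this ⊢
    rw [e]
    exact this
  have step : ∀ (i : ℕ) (a : Fin (p + 1)), (a : ℕ) = i → ∀ x, F a x := by
    intro i
    induction i with
    | zero =>
      intro a ha x
      have : a = 0 := Fin.ext ha
      rw [this]; exact all0 x
    | succ i ih =>
      intro b hb
      have ha : i < p + 1 := by omega
      have ih' := ih ⟨i, ha⟩ rfl
      have low : ∀ x : ℤ, x % 4 < 2 → F b x := by
        intro x hx
        refine force n p hn4 hn γ ⟨i, ha⟩ b (if x % 4 = 0 then x - 1 else x + 1) x (ih' _)
          (by unfold LA; simp only; split_ifs <;> omega) ?_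
        intro b' y' h
        by_cases hc : b' = ⟨i, ha⟩
        · right; left; rw [hc]; exact ih' y'
        · left
          rw [Fin.ext_iff] at hc ⊢
          unfold LA at h
          simp only at h hc
          split_ifs at h <;> omega
      intro x
      by_cases hx : x % 4 < 2
      · exact low x hx
      · refine force n p hn4 hn γ b b (if x % 4 = 2 then x - 1 else x + 1) x
          (low _ (by split_ifs <;> omega)) (by unfold LA; split_ifs <;> omega) ?_
        intro b' y' h
        by_cases hc : b' = ⟨i, ha⟩
        · right; left; rw [hc]; exact ih' y'
        · by_cases hc' : b' = b ∧ y' = x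
          · left; exact hc'
          · right; left
            rw [Fin.ext_iff] at hc
            have : b' = b ∧ y' % 4 < 2 := by
              rw [Fin.ext_iff] at hc' ⊢
              unfold LA at h
              simp only at h hc
              split_ifs at h <;> omega
            rw [this.1]
            exact low _ this.2
  rintro ⟨a, z⟩
  obtain ⟨x, rfl⟩ := exists_lift n z
  exact step a a rfl x

/-! ### Reduction of the index to a finite sum -/

lemma dist_iso_le {V : Type*} (G : SimpleGraph V) (hG : G.Connected) (γ : G ≃g G) (u v : V) :
    G.dist (γ u) (γ v) ≤ G.dist u v := by
  obtain ⟨w, hw⟩ := hG.exists_walk_length_eq_dist u v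
  rw [← hw]
  have := SimpleGraph.dist_le (w.map γ.toHom)
  simpa using this

lemma dist_iso {V : Type*} (G : SimpleGraph V) (hG : G.Connected) (γ : G ≃g G) (u v : V) :
    G.dist (γ u) (γ v) = G.dist u v := by
  apply le_antisymm (dist_iso_le G hG γ u v)
  have := dist_iso_le G hG γ.symm (γ u) (γ v)
  simpa using this

lemma AT_connected (n p : ℕ) (hn4 : n % 4 = 2) (hn : 10 ≤ n) : (AT n p).Connected := by
  have key : ∀ (a b : Fin (p + 1)) (x y : ℤ), (a : ℕ) ≤ b →
      (AT n p).Reachable (a, (x : ZMod (2 * n))) (b, (y : ZMod (2 * n))) := by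
    intro a b x y hab
    obtain ⟨w, _⟩ := walk_upper n p hn4 hn b y
      (|x - y| + |2 * ((b : ℕ) - (a : ℕ) : ℤ) + sp y - sp x| +
        |2 * ((b : ℕ) - (a : ℕ) : ℤ) + sm y - sm x|).toNat a x hab (by
          rw [Int.toNat_of_nonneg (by positivity)]
          have h1 := le_abs_self (x - y)
          have h1' := neg_abs_le (x - y)
          have h2 := le_abs_self (2 * ((b : ℕ) - (a : ℕ) : ℤ) + sp y - sp x)
          have h3 := le_abs_self (2 * ((b : ℕ) - (a : ℕ) : ℤ) + sm y - sm x)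
          have h4 := abs_nonneg (2 * ((b : ℕ) - (a : ℕ) : ℤ) + sp y - sp x)
          have h5 := abs_nonneg (2 * ((b : ℕ) - (a : ℕ) : ℤ) + sm y - sm x)
          have h6 := abs_nonneg (x - y)
          rcases le_total x y with h | h
          · left; refine ⟨h, by linarith, by linarith⟩
          · right; refine ⟨h, by linarith, by linarith⟩)
    exact w.reachable
  have : Nonempty (Fin (p + 1) × ZMod (2 * n)) := ⟨(0, 0)⟩
  refine SimpleGraph.Connected.mk ?_
  rintro ⟨a, z⟩ ⟨b, z'⟩
  obtain ⟨x, rfl⟩ := exists_lift n z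
  obtain ⟨y, rfl⟩ := exists_lift n z'
  rcases le_total (a : ℕ) b with h | h
  · exact key a b x y h
  · exact (key b a y x h).symm

lemma iso_bij (n p : ℕ) (hn4 : n % 4 = 2) (hn : 10 ≤ n) (hp : 3 ≤ p) :
    Function.Bijective (fun z : ZMod (2 * n) => atIso n p hn4 hn (z.val : ℤ)) := by
  have : NeZero (2 * n) := ⟨by omega⟩
  have hcast : ∀ z : ZMod (2 * n), (((z.val : ℕ) : ℤ) : ZMod (2 * n)) = z := by
    intro z; simp
  have h2 : ∀ z : ZMod (2 * n), (atMap n p (z.val : ℤ) (0, ((0 : ℤ) : ZMod (2 * n)))).2 = z := by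
    intro z
    unfold atMap
    simp
  constructor
  · intro z z' h
    have := congrArg (fun γ : AT n p ≃g AT n p => (γ (0, ((0 : ℤ) : ZMod (2 * n)))).2) h
    have h' : (atMap n p (z.val : ℤ) (0, ((0 : ℤ) : ZMod (2 * n)))).2 =
      (atMap n p (z'.val : ℤ) (0, ((0 : ℤ) : ZMod (2 * n)))).2 := this
    rwa [h2, h2] at h'
  · intro α
    set z := (α (0, ((0 : ℤ) : ZMod (2 * n)))).2 with hz
    refine ⟨z, ?_⟩
    have hD : D2 (AT n p) (α (0, ((0 : ℤ) : ZMod (2 * n)))) :=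
      D2_iso _ α _ ((D2_iff n p hn4 hn hp 0 0).2 (by left; simp))
    have e : α (0, ((0 : ℤ) : ZMod (2 * n))) = ((α (0, ((0 : ℤ) : ZMod (2 * n)))).1,
        (((z.val : ℕ) : ℤ) : ZMod (2 * n))) := by
      rw [hcast]
    have h0 : atMap n p (z.val : ℤ) (0, ((0 : ℤ) : ZMod (2 * n))) =
        α (0, ((0 : ℤ) : ZMod (2 * n))) := by
      apply Prod.ext
      · rw [e, D2_iff n p hn4 hn hp] at hD
        unfold atMap
        simp only
        apply Fin.ext
        have hr := Fin.val_rev (0 : Fin (p + 1))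
        have z0 : ((0 : Fin (p + 1)) : ℕ) = 0 := rfl
        split_ifs <;> omega
      · rw [h2]
    set β := atIso n p hn4 hn (z.val : ℤ) with hβ
    have hr := rigid n p hn4 hn hp (α.trans β.symm) (by
      simp only [RelIso.trans_apply]
      rw [← h0]
      exact β.symm_apply_apply _)
    apply RelIso.ext
    intro u
    have := congrArg β (hr u)
    rw [RelIso.trans_apply, RelIso.apply_symm_apply] at this
    exact this.symm

/-- The layer map of the automorphism labelled by `z`. -/
def sg (n p : ℕ) (z : ZMod (2 * n)) (i : Fin (p + 1)) : Fin (p + 1) :=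
  if ((z.val : ℕ) : ℤ) % 4 < 2 then i else Fin.rev i

lemma atIso_apply (n p : ℕ) (hn4 : n % 4 = 2) (hn : 10 ≤ n) (z : ZMod (2 * n)) (i : Fin (p + 1)) :
    atIso n p hn4 hn (z.val : ℤ) (i, ((0 : ℤ) : ZMod (2 * n))) = (sg n p z i, z) := by
  have : NeZero (2 * n) := ⟨by omega⟩
  show atMap n p (z.val : ℤ) (i, ((0 : ℤ) : ZMod (2 * n))) = _
  unfold atMap sg
  simp

lemma GP_reduce (n p : ℕ) (hn4 : n % 4 = 2) (hn : 10 ≤ n) (hp : 3 ≤ p) :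
    GPindex (AT n p) = (n : ℚ) * (p + 1) *
      ∑ i : Fin (p + 1), ∑ x ∈ Finset.range (2 * n),
        ((AT n p).dist (i, ((0 : ℤ) : ZMod (2 * n)))
          (if x % 4 < 2 then i else Fin.rev i, ((x : ℤ) : ZMod (2 * n))) : ℚ) := by
  have hne : NeZero (2 * n) := ⟨by omega⟩
  have hconn := AT_connected n p hn4 hn
  set G := AT n p with hG
  set e := Equiv.ofBijective _ (iso_bij n p hn4 hn hp) with he
  have hcardG : Nat.card (G ≃g G) = 2 * n := by
    rw [← Nat.card_congr e, Nat.card_zmod]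
  set F : Fin (p + 1) × ZMod (2 * n) → ℚ := fun u => ∑ᶠ α : G ≃g G, (G.dist u (α u) : ℚ) with hF
  have hconj : ∀ (β : G ≃g G) u, F (β u) = F u := by
    intro β u
    simp only [hF]
    rw [← finsum_comp_equiv (MulAut.conj β).toEquiv]
    apply finsum_congr
    intro α
    have : ((MulAut.conj β).toEquiv α) (β u) = β (α u) := by
      simp [MulAut.conj_apply, RelIso.mul_apply]
    rw [this, dist_iso G hconn]
  have hF0 : ∀ i : Fin (p + 1), F (i, ((0 : ℤ) : ZMod (2 * n))) = ∑ x ∈ Finset.range (2 * n),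
        (G.dist (i, ((0 : ℤ) : ZMod (2 * n)))
          (if x % 4 < 2 then i else Fin.rev i, ((x : ℤ) : ZMod (2 * n))) : ℚ) := by
    intro i
    simp only [hF]
    rw [← finsum_comp_equiv e, finsum_eq_sum_of_fintype]
    refine Finset.sum_bij (fun z _ => z.val) ?_ ?_ ?_ ?_
    · intro z _
      exact Finset.mem_range.2 (ZMod.val_lt z)
    · intro z _ z' _ h
      exact ZMod.val_injective _ h
    · intro x hx
      exact ⟨(x : ZMod (2 * n)), Finset.mem_univ _, ZMod.val_cast_of_lt (Finset.mem_range.1 hx)⟩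
    · intro z _
      have h1 : (e z) (i, ((0 : ℤ) : ZMod (2 * n))) = (sg n p z i, z) :=
        atIso_apply n p hn4 hn z i
      rw [h1]
      have h2 : sg n p z i = if z.val % 4 < 2 then i else Fin.rev i := by
        unfold sg
        split_ifs <;> first | rfl | omega
      rw [h2]
      simp
  have hsum : ∑ᶠ u, F u = (2 * n : ℚ) * ∑ i : Fin (p + 1), F (i, ((0 : ℤ) : ZMod (2 * n))) := by
    rw [finsum_eq_sum_of_fintype, Fintype.sum_prod_type_right]
    have : ∀ z : ZMod (2 * n), ∑ i : Fin (p + 1), F (i, z) =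
        ∑ i : Fin (p + 1), F (i, ((0 : ℤ) : ZMod (2 * n))) := by
      intro z
      have h1 : ∑ i : Fin (p + 1), F (i, z) = ∑ i : Fin (p + 1), F (sg n p z i, z) := by
        unfold sg
        split_ifs
        · rfl
        · exact (Equiv.sum_comp Fin.revPerm (fun i => F (i, z))).symm
      rw [h1]
      apply Finset.sum_congr rfl
      intro i _
      rw [← atIso_apply n p hn4 hn z i]
      exact hconj _ _
    rw [Finset.sum_congr rfl (fun z _ => this z)]
    rw [Finset.sum_const, Finset.card_univ, ZMod.card]
    simp
  unfold GPindex
  rw [hcardG]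
  have hV : Nat.card (Fin (p + 1) × ZMod (2 * n)) = (p + 1) * (2 * n) := by
    rw [Nat.card_prod, Nat.card_zmod, Nat.card_fin]
  rw [hV]
  change _ * ∑ᶠ u, F u = _
  rw [hsum, Finset.sum_congr rfl (fun i _ => hF0 i)]
  have hn0 : (n : ℚ) ≠ 0 := by
    have : n ≠ 0 := by omega
    exact_mod_cast this
  push_cast
  field_simp

/-! ### Evaluation of the sum -/

/-- The value of the inner sum as a function of the layer parameter. -/
def WW (m s : ℕ) : ℕ :=
  ∑ c ∈ Finset.range m, (32 * c + 16 + 4 * (2 * (s - c))) + (16 * m + 4 + 2 * (2 * (s - m)))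

lemma sum_four (f : ℕ → ℕ) (k : ℕ) : ∑ x ∈ Finset.range (4 * k), f x =
    ∑ c ∈ Finset.range k, (f (4 * c) + f (4 * c + 1) + f (4 * c + 2) + f (4 * c + 3)) := by
  induction k with
  | zero => simp
  | succ k ih =>
    rw [Finset.sum_range_succ, ← ih, show 4 * (k + 1) = 4 * k + 1 + 1 + 1 + 1 by ring]
    simp only [Finset.sum_range_succ]
    ring

lemma sum_fold (f : ℕ → ℕ) (m : ℕ) : ∑ c ∈ Finset.range (2 * m + 1), f c =
    ∑ c ∈ Finset.range m, (f c + f (2 * m - c)) + f m := by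
  rw [show 2 * m + 1 = m + 1 + m by ring, Finset.sum_range_add, Finset.sum_range_succ,
    Finset.sum_add_distrib, ← Finset.sum_range_reflect (fun x => f (m + 1 + x))]
  have : ∑ j ∈ Finset.range m, f (m + 1 + (m - 1 - j)) = ∑ x ∈ Finset.range m, f (2 * m - x) := by
    apply Finset.sum_congr rfl
    intro j hj
    rw [Finset.mem_range] at hj
    congr 1
    omega
  rw [this]
  ring

lemma AT_inner_sum (n m s : ℕ) (hnm : n = 4 * m + 2) :
    ∑ x ∈ Finset.range (2 * n), (if x % 4 < 2 then min x (2 * n - x) else EE n s x) = WW m s := by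
  have h : 2 * n = 4 * (2 * m + 1) := by omega
  set f : ℕ → ℕ := fun x => (if x % 4 < 2 then min x (2 * n - x) else EE n s x) with hf
  have h4 : ∀ c, f (4 * c) + f (4 * c + 1) + f (4 * c + 2) + f (4 * c + 3) =
      min (4 * c) (2 * n - 4 * c) + min (4 * c + 1) (2 * n - (4 * c + 1)) +
      EE n s (4 * c + 2) + EE n s (4 * c + 3) := by
    intro c
    simp only [hf]
    rw [if_pos (by omega), if_pos (by omega), if_neg (by omega), if_neg (by omega)]
  rw [h, sum_four, sum_fold]
  unfold WW
  congr 1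
  · apply Finset.sum_congr rfl
    intro c hc
    rw [Finset.mem_range] at hc
    rw [h4, h4]
    unfold EE
    rw [if_pos (by omega), if_pos (by omega), if_neg (by omega), if_neg (by omega)]
    omega
  · rw [h4]
    unfold EE
    rw [if_pos (by omega), if_neg (by omega)]
    omega

lemma dist_term (n p q : ℕ) (hn4 : n % 4 = 2) (hn : 10 ≤ n) (hq : p = 2 * q + 1)
    (i : Fin (p + 1)) (x : ℕ) (hx : x < 2 * n) :
    (AT n p).dist (i, ((0 : ℤ) : ZMod (2 * n)))
          (if x % 4 < 2 then i else Fin.rev i, ((x : ℤ) : ZMod (2 * n))) =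
      (if x % 4 < 2 then min x (2 * n - x) else
        EE n (if (i : ℕ) ≤ q then p - 2 * i else 2 * i - p - 1) x) := by
  by_cases h : x % 4 < 2
  · rw [if_pos h, if_pos h]
    exact dist_same n p hn4 hn i x hx
  · rw [if_neg h, if_neg h]
    have hi := i.2
    by_cases hi' : (i : ℕ) ≤ q
    · rw [if_pos hi']
      exact dist_up n p hn4 hn i i.rev x _ hx (by omega) (by rw [Fin.val_rev]; omega)
    · rw [if_neg hi']
      exact dist_down n p hn4 hn i i.rev x _ hx (by omega) (by rw [Fin.val_rev]; omega)

lemma sum_perm (f : ℕ → ℕ) (p q : ℕ) (hq : p = 2 * q + 1) :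
    ∑ i ∈ Finset.range (p + 1), f (if i ≤ q then p - 2 * i else 2 * i - p - 1) =
      ∑ s ∈ Finset.range (p + 1), f s := by
  have h2 : ∀ k, ∑ s ∈ Finset.range (2 * k), f s =
      ∑ r ∈ Finset.range k, f (2 * r + 1) + ∑ r ∈ Finset.range k, f (2 * r) := by
    intro k
    induction k with
    | zero => simp
    | succ k ih =>
      rw [show 2 * (k + 1) = 2 * k + 1 + 1 by ring]
      simp only [Finset.sum_range_succ]
      rw [ih]
      ring
  have hr : Finset.range (p + 1) = Finset.range (2 * (q + 1)) := by congr 1; omega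
  conv_rhs => rw [hr, h2]
  rw [show p + 1 = (q + 1) + (q + 1) by omega, Finset.sum_range_add]
  congr 1
  · rw [← Finset.sum_range_reflect (fun r => f (2 * r + 1))]
    apply Finset.sum_congr rfl
    intro i hi
    rw [Finset.mem_range] at hi
    rw [if_pos (by omega)]
    congr 1
    omega
  · apply Finset.sum_congr rfl
    intro i _
    rw [if_neg (by omega)]
    congr 1
    omega

lemma sum_P (p c : ℕ) (hc : c ≤ p) :
    ((∑ s ∈ Finset.range (p + 1), (s - c) : ℕ) : ℚ) = ((p : ℚ) - c) * (p - c + 1) / 2 := by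
  induction p, hc using Nat.le_induction with
  | base =>
    have : ∑ s ∈ Finset.range (c + 1), (s - c) = 0 := by
      apply Finset.sum_eq_zero
      intro s hs
      rw [Finset.mem_range] at hs
      omega
    rw [this]; simp
  | succ p hp ih =>
    rw [Finset.sum_range_succ, Nat.cast_add, ih, Nat.cast_sub (by omega)]
    push_cast
    ring

lemma sum_WW (m p : ℕ) (hm : m ≤ p) :
    ((∑ s ∈ Finset.range (p + 1), WW m s : ℕ) : ℚ) =
      ∑ c ∈ Finset.range m, (((p : ℚ) + 1) * (32 * c + 16) + 4 * (((p : ℚ) - c) * (p - c + 1))) +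
      (((p : ℚ) + 1) * (16 * m + 4) + 2 * (((p : ℚ) - m) * (p - m + 1))) := by
  unfold WW
  rw [Finset.sum_add_distrib, Finset.sum_comm, Nat.cast_add, Nat.cast_sum]
  congr 1
  · apply Finset.sum_congr rfl
    intro c hc
    rw [Finset.mem_range] at hc
    rw [Finset.sum_add_distrib, ← Finset.mul_sum, ← Finset.mul_sum, Nat.cast_add, Nat.cast_mul,
      Nat.cast_mul, sum_P p c (by omega)]
    simp
    ring
  · rw [Finset.sum_add_distrib, ← Finset.mul_sum, ← Finset.mul_sum, Nat.cast_add, Nat.cast_mul,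
      Nat.cast_mul, sum_P p m hm]
    simp
    ring

lemma closed (m : ℕ) (P : ℚ) :
    ∑ c ∈ Finset.range m, ((P + 1) * (32 * (c : ℚ) + 16) + 4 * ((P - c) * (P - c + 1))) =
      (P + 1) * 16 * (m : ℚ) ^ 2 + 4 * (m * P * (P + 1) - (2 * P + 1) * (m * (m - 1) / 2)
        + ((m - 1) * m * (2 * m - 1) / 6)) := by
  induction m with
  | zero => simp
  | succ m ih =>
    rw [Finset.sum_range_succ, ih]
    push_cast
    ring

theorem stmt19 (n p : ℕ) (hp : 3 ≤ p) (hpo : Odd p) (hn4 : n % 4 = 2) (hn : 10 ≤ n)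
    (hle : n ≤ 4 * p) :
    GPindex (AT n p) =
      ((p : ℚ) + 1) * ((n : ℚ) ^ 4 / 48 + 3 * (n : ℚ) ^ 3 * (p : ℚ) / 4 +
        3 * (n : ℚ) ^ 3 / 4 + (n : ℚ) ^ 2 * (p : ℚ) ^ 2 + 2 * (n : ℚ) ^ 2 * (p : ℚ) +
        11 * (n : ℚ) ^ 2 / 12 - (n : ℚ) * (p : ℚ) - (n : ℚ)) := by
  obtain ⟨q, hq⟩ := hpo
  obtain ⟨m, hm⟩ : ∃ m, n = 4 * m + 2 := ⟨n / 4, by omega⟩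
  rw [GP_reduce n p hn4 hn hp]
  have h1 : ∑ i : Fin (p + 1), ∑ x ∈ Finset.range (2 * n),
        ((AT n p).dist (i, ((0 : ℤ) : ZMod (2 * n)))
          (if x % 4 < 2 then i else Fin.rev i, ((x : ℤ) : ZMod (2 * n))) : ℚ) =
      ((∑ s ∈ Finset.range (p + 1), WW m s : ℕ) : ℚ) := by
    rw [← sum_perm (WW m) p q hq,
      ← Fin.sum_univ_eq_sum_range (fun i => WW m (if i ≤ q then p - 2 * i else 2 * i - p - 1)),
      Nat.cast_sum]
    apply Finset.sum_congr rfl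
    intro i _
    rw [← AT_inner_sum n m _ hm, Nat.cast_sum]
    apply Finset.sum_congr rfl
    intro x hx
    rw [dist_term n p q hn4 hn hq i x (Finset.mem_range.1 hx)]
  rw [h1, sum_WW m p (by omega), closed]
  have hnq : (n : ℚ) = 4 * m + 2 := by rw [hm]; push_cast; ring
  rw [hnq]
  ring
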